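/- Let G be an N-function satisfying (H4) with constants p⁻ ≤ p⁺, let 0 < s < 1, Ω ⊂ ℝ^N a bounded domain, and 1 < q ≤ p⁻. Then for all u, v ∈ W^{s,G}_0(Ω) with u > 0 and v > 0 a.e. in Ω and u/v, v/u ∈ L^∞(Ω), the following inequality holds: ∫∫_{ℝ^N×ℝ^N} g(|u(x)−u(y)|/|x−y|^s)·((u(x)−u(y))/|u(x)−u(y)|)·[(u(x)^q − v(x)^q)/u(x)^{q−1} − (u(y)^q − v(y)^q)/u(y)^{q−1}]·dx dy/|x−y|^{N+s} + ∫∫_{ℝ^N×ℝ^N} g(|v(x)−v(y)|/|x−y|^s)·((v(x)−v(y))/|v(x)−v(y)|)·[(v(x)^q − u(x)^q)/v(x)^{q−1} − (v(y)^q − u(y)^q)/v(y)^{q−1}]·dx dy/|x−y|^{N+s} ≥ 0, both integrals being well-defined Lebesgue integrals. -/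

import Mathlib

open MeasureTheory Filter Set
open scoped ENNReal

noncomputable section

abbrev Euc (N : ℕ) := EuclideanSpace ℝ (Fin N)

/-- An N-function: continuous, convex on `[0,∞)`, vanishing exactly at `0`,
with `G t / t → 0` as `t → 0⁺` and `G t / t → ∞` as `t → ∞`. -/
def IsNFunction (G : ℝ → ℝ) : Prop :=
  ContinuousOn G (Set.Ici 0) ∧ ConvexOn ℝ (Set.Ici 0) G ∧
  (∀ t : ℝ, 0 ≤ t → (G t = 0 ↔ t = 0)) ∧
  Tendsto (fun t => G t / t) (nhdsWithin 0 (Set.Ioi 0)) (nhds 0) ∧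
  Tendsto (fun t => G t / t) atTop atTop

/-- The fractional modular `Φ_{s,G}(u) = ∬_{ℝ^N×ℝ^N} G(|u(x)−u(y)|/|x−y|^s) dx dy/|x−y|^N`. -/
def fracModular (G : ℝ → ℝ) (s : ℝ) (N : ℕ) (u : Euc N → ℝ) : ℝ≥0∞ :=
  ∫⁻ p : Euc N × Euc N,
    ENNReal.ofReal (G (|u p.1 - u p.2| / dist p.1 p.2 ^ s) / dist p.1 p.2 ^ (N : ℝ))

/-- Membership in `W^{s,G}_0(Ω)`: measurable, in `L^G(ℝ^N)`, finite fractional modular for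
some `λ > 0`, and vanishing outside `Ω`. -/
def MemW0 (G : ℝ → ℝ) (s : ℝ) {N : ℕ} (Ω : Set (Euc N)) (u : Euc N → ℝ) : Prop :=
  Measurable u ∧
  (∃ l > 0, (∫⁻ x, ENNReal.ofReal (G (|u x| / l))) ≤ 1) ∧
  (∃ l > 0, fracModular G s N (fun x => u x / l) < ⊤) ∧
  (∀ x ∉ Ω, u x = 0)

/-- The integrand of the G-fractional Díaz–Saa form:
`g(|u(x)−u(y)|/|x−y|^s) · sign(u(x)−u(y)) ·
  [(u(x)^q − v(x)^q)/u(x)^{q−1} − (u(y)^q − v(y)^q)/u(y)^{q−1}] / |x−y|^{N+s}`. -/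
def diazSaaIntegrand (g : ℝ → ℝ) (s q : ℝ) (N : ℕ) (u v : Euc N → ℝ)
    (p : Euc N × Euc N) : ℝ :=
  g (|u p.1 - u p.2| / dist p.1 p.2 ^ s) * Real.sign (u p.1 - u p.2) *
    ((u p.1 ^ q - v p.1 ^ q) / u p.1 ^ (q - 1)
      - (u p.2 ^ q - v p.2 ^ q) / u p.2 ^ (q - 1)) /
    dist p.1 p.2 ^ ((N : ℝ) + s)

/-- Young's inequality in the form of the supporting planes of the perspective
`(b, d) ↦ d ^ q / b ^ (q - 1)` of the power function. -/
lemma support_le_rpow_div {q : ℝ} (hq : 1 < q) {z b d : ℝ} (hz : 0 < z)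
    (h : (0 < b ∧ 0 ≤ d) ∨ (b = 0 ∧ d = 0)) :
    q * z ^ (q - 1) * d - (q - 1) * z ^ q * b ≤ d ^ q / b ^ (q - 1) := by
  rcases h with ⟨hb, hd⟩ | ⟨rfl, rfl⟩
  · obtain ⟨w, hw, rfl⟩ : ∃ w, 0 ≤ w ∧ d = z * w * b :=
      ⟨d / b / z, by positivity, by field_simp⟩
    have hB := one_add_mul_self_le_rpow_one_add (s := w - 1) (by linarith) hq.le
    rw [add_sub_cancel] at hB
    have hzq : z ^ q = z ^ (q - 1) * z := by
      rw [Real.rpow_sub_one hz.ne']; field_simp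
    have hbq : b ^ q = b ^ (q - 1) * b := by
      rw [Real.rpow_sub_one hb.ne']; field_simp
    rw [Real.mul_rpow (by positivity) hb.le, Real.mul_rpow hz.le hw, hbq, le_div_iff₀ (by positivity),
      hzq]
    have h1 : 0 < z ^ (q - 1) := by positivity
    have h2 : 0 < b ^ (q - 1) := by positivity
    have := mul_le_mul_of_nonneg_left hB (by positivity : 0 ≤ z ^ (q - 1) * z * b ^ (q - 1) * b)
    nlinarith [this]
  · simp [Real.zero_rpow (by linarith : q ≠ 0)]

lemma rpow_div_eq_support {q a c : ℝ} (ha : 0 < a) (hc : 0 < c) :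
    c ^ q / a ^ (q - 1) = q * (c / a) ^ (q - 1) * c - (q - 1) * (c / a) ^ q * a := by
  rw [Real.div_rpow hc.le ha.le, Real.div_rpow hc.le ha.le, Real.rpow_sub_one hc.ne',
    Real.rpow_sub_one ha.ne']
  have : 0 < a ^ q := by positivity
  field_simp
  ring

/-- The values `a` and `c` are comparable with constant `M`: both vanish, or both are positive and
their ratios are at most `M`. -/
def Comparable (M a c : ℝ) : Prop :=
  (0 < a ∧ 0 < c ∧ a ≤ M * c ∧ c ≤ M * a) ∨ (a = 0 ∧ c = 0)

lemma Comparable.symm {M a c : ℝ} (h : Comparable M a c) : Comparable M c a := by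
  rcases h with ⟨h1, h2, h3, h4⟩ | ⟨h1, h2⟩
  · exact Or.inl ⟨h2, h1, h4, h3⟩
  · exact Or.inr ⟨h2, h1⟩

lemma Comparable.pos_or_zero {M a c : ℝ} (h : Comparable M a c) :
    (0 < a ∧ 0 ≤ c) ∨ (a = 0 ∧ c = 0) := by
  rcases h with ⟨h1, h2, -, -⟩ | h
  · exact Or.inl ⟨h1, h2.le⟩
  · exact Or.inr h

lemma Comparable.nonneg {M a c : ℝ} (h : Comparable M a c) : 0 ≤ a := by
  rcases h with ⟨h1, -⟩ | ⟨h1, -⟩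
  · exact h1.le
  · exact h1.ge

lemma Comparable.sub_div_eq {q M a c : ℝ} (hq : 1 < q) (h : Comparable M a c) :
    (a ^ q - c ^ q) / a ^ (q - 1) = a - c ^ q / a ^ (q - 1) := by
  rcases h with ⟨ha, -⟩ | ⟨rfl, rfl⟩
  · have : 0 < a ^ q := by positivity
    rw [sub_div, Real.rpow_sub_one ha.ne']
    field_simp
  · simp [Real.zero_rpow (by linarith : q ≠ 0)]

/-- The discrete Picone inequality for `b < a`. -/
lemma picone_of_lt {q M a b c d : ℝ} (hq : 1 < q) (h1 : Comparable M a c) (h2 : Comparable M b d)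
    (hab : b < a) :
    (a - b) ^ (q - 1) * (c ^ q / a ^ (q - 1) - d ^ q / b ^ (q - 1)) ≤ |c - d| ^ q := by
  have hb := h2.nonneg
  have ha : 0 < a := hb.trans_lt hab
  have hc : 0 < c := by
    rcases h1 with h | h
    · exact h.2.1
    · exact absurd h.1 ha.ne'
  have hz : 0 < c / a := by positivity
  have hA : 0 < a - b := sub_pos.2 hab
  have e := rpow_div_eq_support (q := q) ha hc
  have s1 := support_le_rpow_div hq hz h2.pos_or_zero
  have s2 := support_le_rpow_div hq hz (Or.inl ⟨hA, abs_nonneg (c - d)⟩)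
  have hk : 0 ≤ q * (c / a) ^ (q - 1) := by positivity
  have s3 := mul_le_mul_of_nonneg_left (le_abs_self (c - d)) hk
  have key : c ^ q / a ^ (q - 1) - d ^ q / b ^ (q - 1) ≤ |c - d| ^ q / (a - b) ^ (q - 1) := by
    rw [e]; linarith
  rw [le_div_iff₀ (by positivity)] at key
  linarith

lemma picone {q M a b c d : ℝ} (hq : 1 < q) (h1 : Comparable M a c) (h2 : Comparable M b d) :
    |a - b| ^ (q - 1) * (Real.sign (a - b) * (c ^ q / a ^ (q - 1) - d ^ q / b ^ (q - 1)))
      ≤ |c - d| ^ q := by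
  rcases lt_trichotomy a b with h | rfl | h
  · have := picone_of_lt hq h2 h1 h
    rw [Real.sign_of_neg (by linarith), abs_of_neg (sub_neg.2 h), abs_sub_comm c d, neg_sub]
    linarith
  · simp only [sub_self, Real.sign_zero, zero_mul, mul_zero]
    positivity
  · have := picone_of_lt hq h1 h2 h
    rw [Real.sign_of_pos (by linarith), abs_of_pos (sub_pos.2 h)]
    linarith

lemma Comparable.rpow_div_sub_le {q M a b c d : ℝ} (hq : 1 < q) (hM : 0 ≤ M)
    (h1 : Comparable M a c) (h2 : Comparable M b d) :
    c ^ q / a ^ (q - 1) - d ^ q / b ^ (q - 1)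
      ≤ q * M ^ (q - 1) * |c - d| + (q - 1) * M ^ q * |a - b| := by
  rcases h1 with ⟨ha, hc, -, hca⟩ | ⟨rfl, rfl⟩
  · have hz : 0 < c / a := by positivity
    have hzM : c / a ≤ M := by rwa [div_le_iff₀ ha]
    have e := rpow_div_eq_support (q := q) ha hc
    have s1 := support_le_rpow_div hq hz h2.pos_or_zero
    have hk : q * (c / a) ^ (q - 1) * (c - d) ≤ q * M ^ (q - 1) * |c - d| := by
      refine (mul_le_mul_of_nonneg_left (le_abs_self _) (by positivity)).trans ?_
      gcongr
    have hk' : (q - 1) * (c / a) ^ q * (b - a) ≤ (q - 1) * M ^ q * |a - b| := by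
      have hq' : 0 ≤ q - 1 := by linarith
      rw [abs_sub_comm]
      refine (mul_le_mul_of_nonneg_left (le_abs_self _) (by positivity)).trans ?_
      gcongr
    rw [e]; linarith
  · have hq' : 0 ≤ q - 1 := by linarith
    have hd := h2.symm.nonneg
    have hb := h2.nonneg
    rw [Real.zero_rpow (by linarith), zero_div, zero_sub]
    have h3 : 0 ≤ d ^ q / b ^ (q - 1) := by positivity
    have h4 : 0 ≤ q * M ^ (q - 1) * |0 - d| + (q - 1) * M ^ q * |0 - b| := by positivity
    linarith

lemma Comparable.abs_bracket_le {q M a b c d : ℝ} (hq : 1 < q) (hM : 0 ≤ M)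
    (h1 : Comparable M a c) (h2 : Comparable M b d) :
    |(a ^ q - c ^ q) / a ^ (q - 1) - (b ^ q - d ^ q) / b ^ (q - 1)|
      ≤ (1 + q * M ^ (q - 1) + (q - 1) * M ^ q) * (|a - b| + |c - d|) := by
  have l1 := h1.rpow_div_sub_le hq hM h2
  have l2 := h2.rpow_div_sub_le hq hM h1
  rw [abs_sub_comm d c, abs_sub_comm b a] at l2
  rw [h1.sub_div_eq hq, h2.sub_div_eq hq]
  have hq' : 0 ≤ q - 1 := by linarith
  have k1 : 0 ≤ q * M ^ (q - 1) * |a - b| := by positivity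
  have k2 : 0 ≤ (q - 1) * M ^ q * |c - d| := by positivity
  have k3 := abs_nonneg (c - d)
  have k4 := le_abs_self (a - b)
  have k5 := neg_abs_le (a - b)
  rw [abs_le]
  constructor <;> nlinarith

lemma monotoneOn_div_rpow {g g' : ℝ → ℝ} {k : ℝ} (hpos : ∀ t : ℝ, 0 < t → 0 < g t)
    (hgg' : ∀ t : ℝ, 0 < t → HasDerivAt g (g' t) t)
    (hk : ∀ t : ℝ, 0 < t → k ≤ t * g' t / g t) :
    MonotoneOn (fun t => g t / t ^ k) (Ioi 0) := by
  have hd : ∀ t : ℝ, 0 < t → HasDerivAt (fun t => g t / t ^ k)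
      ((g' t * t ^ k - g t * (k * t ^ (k - 1))) / (t ^ k) ^ 2) t := fun t ht =>
    (hgg' t ht).div (Real.hasDerivAt_rpow_const (Or.inl ht.ne')) (by positivity)
  refine monotoneOn_of_deriv_nonneg (convex_Ioi 0)
    (fun t ht => (hd t ht).continuousAt.continuousWithinAt)
    (fun t ht => (hd t (by simpa using ht)).differentiableAt.differentiableWithinAt) ?_
  intro t ht
  rw [interior_Ioi] at ht
  have ht' : 0 < t := ht
  rw [(hd t ht).deriv]
  have h := hk t ht
  rw [le_div_iff₀ (hpos t ht)] at h
  refine div_nonneg ?_ (by positivity)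
  have e : t ^ k = t ^ (k - 1) * t := by rw [Real.rpow_sub_one ht'.ne']; field_simp
  rw [e]
  have : 0 < t ^ (k - 1) := by positivity
  nlinarith

lemma antitoneOn_div_rpow {g g' : ℝ → ℝ} {k : ℝ} (hpos : ∀ t : ℝ, 0 < t → 0 < g t)
    (hgg' : ∀ t : ℝ, 0 < t → HasDerivAt g (g' t) t)
    (hk : ∀ t : ℝ, 0 < t → t * g' t / g t ≤ k) :
    AntitoneOn (fun t => g t / t ^ k) (Ioi 0) := by
  have hd : ∀ t : ℝ, 0 < t → HasDerivAt (fun t => g t / t ^ k)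
      ((g' t * t ^ k - g t * (k * t ^ (k - 1))) / (t ^ k) ^ 2) t := fun t ht =>
    (hgg' t ht).div (Real.hasDerivAt_rpow_const (Or.inl ht.ne')) (by positivity)
  refine antitoneOn_of_deriv_nonpos (convex_Ioi 0)
    (fun t ht => (hd t ht).continuousAt.continuousWithinAt)
    (fun t ht => (hd t (by simpa using ht)).differentiableAt.differentiableWithinAt) ?_
  intro t ht
  rw [interior_Ioi] at ht
  have ht' : 0 < t := ht
  rw [(hd t ht).deriv]
  have h := hk t ht
  rw [div_le_iff₀ (hpos t ht)] at h
  refine div_nonpos_of_nonpos_of_nonneg ?_ (by positivity)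
  have e : t ^ k = t ^ (k - 1) * t := by rw [Real.rpow_sub_one ht'.ne']; field_simp
  rw [e]
  have : 0 < t ^ (k - 1) := by positivity
  nlinarith

lemma IsNFunction.pos {G : ℝ → ℝ} (hG : IsNFunction G) {t : ℝ} (ht : 0 < t) : 0 < G t := by
  obtain ⟨-, hconv, hzero, hlim, -⟩ := hG
  have hG0 : G 0 = 0 := (hzero 0 le_rfl).2 rfl
  have h0 : 0 ≤ G t / t := by
    refine le_of_tendsto hlim ?_
    filter_upwards [Ioo_mem_nhdsGT ht] with r hr
    have hr0 : 0 < r := hr.1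
    have := hconv.secant_mono (a := 0) (x := r) (y := t) (by simp) hr0.le ht.le hr0.ne' ht.ne'
      hr.2.le
    simpa [hG0] using this
  have h1 : 0 ≤ G t := by
    have := mul_nonneg h0 ht.le
    rwa [div_mul_cancel₀ _ ht.ne'] at this
  exact lt_of_le_of_ne h1 fun h => ht.ne' ((hzero t ht.le).1 h.symm)

lemma IsNFunction.deriv_pos {G g : ℝ → ℝ} (hG : IsNFunction G)
    (hGg : ∀ t : ℝ, 0 < t → HasDerivAt G (g t) t) {t : ℝ} (ht : 0 < t) : 0 < g t := by
  have hG0 : G 0 = 0 := (hG.2.2.1 0 le_rfl).2 rfl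
  have := hG.2.1.slope_le_of_hasDerivAt (x := 0) (y := t) (by simp) ht.le ht (hGg t ht)
  rw [slope_def_field, hG0, sub_zero, sub_zero] at this
  exact (div_pos (hG.pos ht) ht).trans_le this

lemma IsNFunction.mul_deriv_le {G g : ℝ → ℝ} (hG : IsNFunction G)
    (hGg : ∀ t : ℝ, 0 < t → HasDerivAt G (g t) t) {t : ℝ} (ht : 0 < t) :
    t * g t ≤ G (2 * t) := by
  have := hG.2.1.le_slope_of_hasDerivAt (x := t) (y := 2 * t) ht.le (by simp; linarith)
    (by linarith) (hGg t ht)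
  rw [slope_def_field, le_div_iff₀ (by linarith)] at this
  have := hG.pos ht
  nlinarith

/-- Under the upper growth bound, `t * g t` is controlled by `G (t / l)` for every `l > 0`. -/
lemma IsNFunction.exists_mul_deriv_le {G g g' : ℝ → ℝ} {k : ℝ} (hG : IsNFunction G)
    (hGg : ∀ t : ℝ, 0 < t → HasDerivAt G (g t) t)
    (hgg' : ∀ t : ℝ, 0 < t → HasDerivAt g (g' t) t)
    (hk0 : ∀ t : ℝ, 0 < t → 0 ≤ t * g' t / g t)
    (hk : ∀ t : ℝ, 0 < t → t * g' t / g t ≤ k) {l : ℝ} (hl : 0 < l) :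
    ∃ C : ℝ, 0 ≤ C ∧ ∀ t : ℝ, 0 ≤ t → g t * t ≤ C * G (t / l) := by
  have hpos : ∀ t : ℝ, 0 < t → 0 < g t := fun t ht => hG.deriv_pos hGg ht
  have hgrow : ∃ C : ℝ, 0 ≤ C ∧ ∀ r : ℝ, 0 < r → g (2 * l * r) ≤ C * g r := by
    rcases le_total (2 * l) 1 with h | h
    · refine ⟨1, zero_le_one, fun r hr => ?_⟩
      have := monotoneOn_div_rpow hpos hgg' hk0 (a := 2 * l * r) (b := r)
        (mem_Ioi.2 (by positivity)) hr (by nlinarith)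
      simpa using this
    · refine ⟨(2 * l) ^ k, by positivity, fun r hr => ?_⟩
      have := antitoneOn_div_rpow hpos hgg' hk (a := r) (b := 2 * l * r)
        hr (mem_Ioi.2 (by positivity)) (by nlinarith)
      simp only at this
      rw [Real.mul_rpow (by positivity) hr.le, div_le_div_iff₀ (by positivity) (by positivity)]
        at this
      have hrk : 0 < r ^ k := by positivity
      exact le_of_mul_le_mul_right (by linarith) hrk
  obtain ⟨C, hC, hgC⟩ := hgrow
  refine ⟨C * (2 * l), by positivity, fun t ht => ?_⟩
  rcases ht.eq_or_lt with rfl | ht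
  · simp [(hG.2.2.1 0 le_rfl).2 rfl]
  · obtain ⟨r, hr, rfl⟩ : ∃ r, 0 < r ∧ t = 2 * l * r := ⟨t / (2 * l), by positivity, by field_simp⟩
    have h1 := hG.mul_deriv_le hGg hr
    have h2 := hgC r hr
    have e : 2 * l * r / l = 2 * r := by field_simp
    rw [e]
    calc g (2 * l * r) * (2 * l * r) ≤ C * g r * (2 * l * r) := by gcongr
      _ = C * (2 * l) * (r * g r) := by ring
      _ ≤ C * (2 * l) * G (2 * r) := by gcongr

/-- The fractional difference quotient `|u(x) - u(y)| / |x - y| ^ s`. -/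
def fracQuot (s : ℝ) {N : ℕ} (u : Euc N → ℝ) (p : Euc N × Euc N) : ℝ :=
  |u p.1 - u p.2| / dist p.1 p.2 ^ s

lemma fracQuot_nonneg (s : ℝ) {N : ℕ} (u : Euc N → ℝ) (p : Euc N × Euc N) :
    0 ≤ fracQuot s u p := by
  unfold fracQuot; positivity

lemma measurable_fracQuot (s : ℝ) {N : ℕ} {u : Euc N → ℝ} (hu : Measurable u) :
    Measurable (fracQuot s u) := by
  unfold fracQuot
  exact ((hu.comp measurable_fst).sub (hu.comp measurable_snd)).abs.div
    (measurable_dist.pow_const s)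

lemma measurable_indicator_Ioi {g : ℝ → ℝ} (hg : ContinuousOn g (Ioi 0)) :
    Measurable ((Ioi (0 : ℝ)).indicator g) := by
  classical
  rw [← Set.piecewise_eq_indicator]
  exact hg.measurable_piecewise continuousOn_const measurableSet_Ioi

lemma MemW0.integrable_energy {N : ℕ} {G g g' : ℝ → ℝ} {k s : ℝ} {Ω : Set (Euc N)}
    {u : Euc N → ℝ} (hG : IsNFunction G)
    (hGg : ∀ t : ℝ, 0 < t → HasDerivAt G (g t) t)
    (hgg' : ∀ t : ℝ, 0 < t → HasDerivAt g (g' t) t)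
    (hk0 : ∀ t : ℝ, 0 < t → 0 ≤ t * g' t / g t)
    (hk : ∀ t : ℝ, 0 < t → t * g' t / g t ≤ k) (hu : MemW0 G s Ω u) :
    Integrable (fun p : Euc N × Euc N =>
      g (fracQuot s u p) * fracQuot s u p / dist p.1 p.2 ^ (N : ℝ)) := by
  obtain ⟨hum, -, ⟨l, hl, hfin⟩, -⟩ := hu
  obtain ⟨C, hC, hgC⟩ := hG.exists_mul_deriv_le hGg hgg' hk0 hk hl
  have hgt : ∀ t : ℝ, 0 ≤ t → g t * t = (Ioi (0 : ℝ)).indicator g t * t := by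
    intro t ht
    rcases ht.eq_or_lt with rfl | ht
    · simp
    · rw [indicator_of_mem (mem_Ioi.2 ht)]
  have hgnn : ∀ t : ℝ, 0 ≤ t → 0 ≤ g t * t := by
    intro t ht
    rcases ht.eq_or_lt with rfl | ht
    · simp
    · exact (mul_pos (hG.deriv_pos hGg ht) ht).le
  refine ⟨?_, ?_⟩
  · have e : (fun p : Euc N × Euc N =>
        g (fracQuot s u p) * fracQuot s u p / dist p.1 p.2 ^ (N : ℝ)) = fun p =>
        (Ioi (0 : ℝ)).indicator g (fracQuot s u p) * fracQuot s u p / dist p.1 p.2 ^ (N : ℝ) := by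
      funext p
      rw [hgt _ (fracQuot_nonneg s u p)]
    rw [e]
    have hm := measurable_fracQuot s hum
    have hi := measurable_indicator_Ioi
      (fun t ht => (hgg' t ht).continuousAt.continuousWithinAt : ContinuousOn g (Ioi 0))
    exact (((hi.comp hm).mul hm).div (measurable_dist.pow_const _)).aestronglyMeasurable
  · rw [hasFiniteIntegral_iff_ofReal]
    · refine lt_of_le_of_lt ?_ (ENNReal.mul_lt_top (ENNReal.ofReal_lt_top (r := C)) hfin)
      rw [fracModular, ← lintegral_const_mul' _ _ ENNReal.ofReal_ne_top]
      refine lintegral_mono fun p => ?_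
      rw [← ENNReal.ofReal_mul hC]
      refine ENNReal.ofReal_le_ofReal ?_
      have e : |u p.1 / l - u p.2 / l| / dist p.1 p.2 ^ s = fracQuot s u p / l := by
        rw [← sub_div, abs_div, abs_of_pos hl, fracQuot]; ring
      rw [e, ← mul_div_assoc]
      refine div_le_div_of_nonneg_right ?_ (by positivity)
      exact hgC _ (fracQuot_nonneg s u p)
    · exact Eventually.of_forall fun p =>
        div_nonneg (hgnn _ (fracQuot_nonneg s u p)) (by positivity)

lemma diazSaaIntegrand_eq_of_pos {N : ℕ} (g : ℝ → ℝ) (s q : ℝ) (u v : Euc N → ℝ)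
    {p : Euc N × Euc N} (hp : 0 < dist p.1 p.2) :
    diazSaaIntegrand g s q N u v p =
      g (fracQuot s u p) * Real.sign (u p.1 - u p.2) *
        ((u p.1 ^ q - v p.1 ^ q) / u p.1 ^ (q - 1)
          - (u p.2 ^ q - v p.2 ^ q) / u p.2 ^ (q - 1)) / dist p.1 p.2 ^ s
        / dist p.1 p.2 ^ (N : ℝ) := by
  rw [diazSaaIntegrand, fracQuot, Real.rpow_add hp, div_div, mul_comm (dist p.1 p.2 ^ s)]

lemma diazSaaIntegrand_eq_zero {N : ℕ} (g : ℝ → ℝ) (s q : ℝ) (u v : Euc N → ℝ)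
    {p : Euc N × Euc N} (hp : u p.1 = u p.2) : diazSaaIntegrand g s q N u v p = 0 := by
  simp [diazSaaIntegrand, hp]

lemma abs_diazSaaIntegrand_le {N : ℕ} {g : ℝ → ℝ} {s q M : ℝ} {u v : Euc N → ℝ} (hq : 1 < q)
    (hM : 0 ≤ M) (hpos : ∀ t : ℝ, 0 < t → 0 < g t) (hmono : MonotoneOn g (Ioi 0))
    {p : Euc N × Euc N} (h1 : Comparable M (u p.1) (v p.1)) (h2 : Comparable M (u p.2) (v p.2)) :
    |diazSaaIntegrand g s q N u v p| ≤ (1 + q * M ^ (q - 1) + (q - 1) * M ^ q) *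
      (2 * (g (fracQuot s u p) * fracQuot s u p / dist p.1 p.2 ^ (N : ℝ)) +
        g (fracQuot s v p) * fracQuot s v p / dist p.1 p.2 ^ (N : ℝ)) := by
  have hq' : 0 ≤ q - 1 := by linarith
  have hnn : ∀ t : ℝ, 0 ≤ t → 0 ≤ g t * t := by
    intro t ht
    rcases ht.eq_or_lt with rfl | ht
    · simp
    · exact (mul_pos (hpos t ht) ht).le
  have hT := fracQuot_nonneg s u p
  have hS := fracQuot_nonneg s v p
  have hgT := hnn _ hT
  have hgS := hnn _ hS
  by_cases huv : u p.1 = u p.2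
  · rw [diazSaaIntegrand_eq_zero g s q u v huv, abs_zero]
    positivity
  have hp : 0 < dist p.1 p.2 := dist_pos.2 fun h => huv (by rw [h])
  have hTpos : 0 < fracQuot s u p :=
    div_pos (abs_pos.2 (sub_ne_zero.2 huv)) (by positivity)
  have hcross : g (fracQuot s u p) * fracQuot s v p ≤
      g (fracQuot s u p) * fracQuot s u p + g (fracQuot s v p) * fracQuot s v p := by
    have hgp := hpos _ hTpos
    rcases le_total (fracQuot s v p) (fracQuot s u p) with h | h
    · have := mul_le_mul_of_nonneg_left h hgp.le
      linarith
    · have := mul_le_mul_of_nonneg_right (hmono hTpos (hTpos.trans_le h) h) hS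
      linarith
  have hsign : |Real.sign (u p.1 - u p.2)| ≤ 1 := by
    rcases Real.sign_apply_eq (u p.1 - u p.2) with h | h | h <;> simp [h]
  have hbr := h1.abs_bracket_le hq hM h2
  rw [diazSaaIntegrand_eq_of_pos g s q u v hp, abs_div, abs_div, abs_mul, abs_mul,
    abs_of_pos (hpos _ hTpos), abs_of_pos (by positivity : 0 < dist p.1 p.2 ^ s),
    abs_of_pos (by positivity : 0 < dist p.1 p.2 ^ (N : ℝ))]
  have hgp := hpos _ hTpos
  set K := 1 + q * M ^ (q - 1) + (q - 1) * M ^ q with hK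
  have hK0 : 0 ≤ K := by positivity
  calc _ ≤ g (fracQuot s u p) * 1 * (K * (|u p.1 - u p.2| + |v p.1 - v p.2|))
        / dist p.1 p.2 ^ s / dist p.1 p.2 ^ (N : ℝ) := by gcongr
    _ = K * (g (fracQuot s u p) * fracQuot s u p + g (fracQuot s u p) * fracQuot s v p)
        / dist p.1 p.2 ^ (N : ℝ) := by unfold fracQuot; ring
    _ ≤ K * (g (fracQuot s u p) * fracQuot s u p +
          (g (fracQuot s u p) * fracQuot s u p + g (fracQuot s v p) * fracQuot s v p))
        / dist p.1 p.2 ^ (N : ℝ) := by gcongr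
    _ = _ := by ring

lemma measurable_diazSaaIntegrand {N : ℕ} {g : ℝ → ℝ} {s q : ℝ} {u v : Euc N → ℝ}
    (hg : ContinuousOn g (Ioi 0)) (hu : Measurable u) (hv : Measurable v) :
    Measurable (diazSaaIntegrand g s q N u v) := by
  have e : diazSaaIntegrand g s q N u v =
      diazSaaIntegrand ((Ioi (0 : ℝ)).indicator g) s q N u v := by
    funext p
    by_cases huv : u p.1 = u p.2
    · simp [diazSaaIntegrand_eq_zero, huv]
    · have hp : 0 < dist p.1 p.2 := dist_pos.2 fun h => huv (by rw [h])
      have hT : |u p.1 - u p.2| / dist p.1 p.2 ^ s ∈ Ioi (0 : ℝ) :=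
        div_pos (abs_pos.2 (sub_ne_zero.2 huv)) (by positivity)
      rw [diazSaaIntegrand, diazSaaIntegrand, indicator_of_mem hT]
  have hsign : Measurable Real.sign :=
    Measurable.ite measurableSet_Iio measurable_const
      (Measurable.ite measurableSet_Ioi measurable_const measurable_const)
  have hu1 : Measurable fun p : Euc N × Euc N => u p.1 := hu.comp measurable_fst
  have hu2 : Measurable fun p : Euc N × Euc N => u p.2 := hu.comp measurable_snd
  have hv1 : Measurable fun p : Euc N × Euc N => v p.1 := hv.comp measurable_fst
  have hv2 : Measurable fun p : Euc N × Euc N => v p.2 := hv.comp measurable_snd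
  rw [e]
  exact ((((measurable_indicator_Ioi hg).comp (measurable_fracQuot s hu)).mul
    (hsign.comp (hu1.sub hu2))).mul
    ((((hu1.pow_const q).sub (hv1.pow_const q)).div (hu1.pow_const (q - 1))).sub
      (((hu2.pow_const q).sub (hv2.pow_const q)).div (hu2.pow_const (q - 1))))).div
    (measurable_dist.pow_const _)

lemma le_diazSaa_bracket {q M r a b c d : ℝ} {g : ℝ → ℝ} (hq : 1 < q) (hr : 0 < r)
    (hpos : ∀ t : ℝ, 0 < t → 0 < g t) (h1 : Comparable M a c) (h2 : Comparable M b d) :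
    g (|a - b| / r) / (|a - b| / r) ^ (q - 1) * (|a - b| ^ q - |c - d| ^ q) / r ^ (q - 1) ≤
      g (|a - b| / r) * Real.sign (a - b) *
        ((a ^ q - c ^ q) / a ^ (q - 1) - (b ^ q - d ^ q) / b ^ (q - 1)) := by
  rcases eq_or_ne a b with rfl | hab
  · simp [Real.zero_rpow (by linarith : q - 1 ≠ 0)]
  have hA : 0 < |a - b| := abs_pos.2 (sub_ne_zero.2 hab)
  have hg := hpos (|a - b| / r) (by positivity)
  have hP := picone hq h1 h2
  have hs : Real.sign (a - b) * (a - b) = |a - b| := by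
    rcases lt_or_gt_of_ne (sub_ne_zero.2 hab) with h | h
    · rw [Real.sign_of_neg h, abs_of_neg h]; ring
    · rw [Real.sign_of_pos h, abs_of_pos h]; ring
  have hAq : |a - b| ^ q = |a - b| ^ (q - 1) * |a - b| := by
    rw [Real.rpow_sub_one hA.ne']; field_simp
  rw [h1.sub_div_eq hq, h2.sub_div_eq hq, Real.div_rpow hA.le hr.le]
  have hAk : 0 < |a - b| ^ (q - 1) := by positivity
  have hrk : 0 < r ^ (q - 1) := by positivity
  calc _ = g (|a - b| / r) * ((|a - b| ^ q - |c - d| ^ q) / |a - b| ^ (q - 1)) := by field_simp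
    _ ≤ g (|a - b| / r) * (|a - b| -
        Real.sign (a - b) * (c ^ q / a ^ (q - 1) - d ^ q / b ^ (q - 1))) := by
      gcongr
      rw [div_le_iff₀ hAk, hAq]
      linarith
    _ = _ := by rw [← hs]; ring

lemma diazSaaIntegrand_add_nonneg {N : ℕ} {g : ℝ → ℝ} {s q M : ℝ} {u v : Euc N → ℝ} (hq : 1 < q)
    (hpos : ∀ t : ℝ, 0 < t → 0 < g t) (hmono : MonotoneOn (fun t => g t / t ^ (q - 1)) (Ioi 0))
    {p : Euc N × Euc N} (h1 : Comparable M (u p.1) (v p.1)) (h2 : Comparable M (u p.2) (v p.2)) :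
    0 ≤ diazSaaIntegrand g s q N u v p + diazSaaIntegrand g s q N v u p := by
  by_cases hp0 : p.1 = p.2
  · simp [diazSaaIntegrand, hp0]
  have hp : 0 < dist p.1 p.2 := dist_pos.2 hp0
  have hr : 0 < dist p.1 p.2 ^ s := by positivity
  have hmono' : MonotoneOn (fun t => g t / t ^ (q - 1)) (Ici 0) := by
    intro x hx y hy hxy
    rcases (mem_Ici.1 hx).eq_or_lt with rfl | hx
    · rcases (mem_Ici.1 hy).eq_or_lt with rfl | hy
      · exact le_rfl
      · have := hpos y hy
        simp only [Real.zero_rpow (by linarith : q - 1 ≠ 0), div_zero]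
        positivity
    · exact hmono hx (hx.trans_le hxy) hxy
  have t1 := le_diazSaa_bracket hq hr hpos h1 h2
  have t2 := le_diazSaa_bracket hq hr hpos h1.symm h2.symm
  set A := |u p.1 - u p.2| with hA
  set C := |v p.1 - v p.2| with hC
  have hA0 : 0 ≤ A := abs_nonneg _
  have hC0 : 0 ≤ C := abs_nonneg _
  have key : ∀ {x y : ℝ}, 0 ≤ x → x ≤ y →
      0 ≤ (g (y / dist p.1 p.2 ^ s) / (y / dist p.1 p.2 ^ s) ^ (q - 1) -
        g (x / dist p.1 p.2 ^ s) / (x / dist p.1 p.2 ^ s) ^ (q - 1)) * (y ^ q - x ^ q) := by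
    intro x y hx hxy
    refine mul_nonneg (sub_nonneg.2 (hmono' (mem_Ici.2 (by positivity))
      (mem_Ici.2 (div_nonneg (hx.trans hxy) hr.le)) (by gcongr))) (sub_nonneg.2 ?_)
    gcongr
  have hk : 0 ≤ g (A / dist p.1 p.2 ^ s) / (A / dist p.1 p.2 ^ s) ^ (q - 1) * (A ^ q - C ^ q) +
      g (C / dist p.1 p.2 ^ s) / (C / dist p.1 p.2 ^ s) ^ (q - 1) * (C ^ q - A ^ q) := by
    rcases le_total A C with h | h
    · linarith [key hA0 h]
    · linarith [key hC0 h]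
  have hsum := div_nonneg hk (by positivity : 0 ≤ (dist p.1 p.2 ^ s) ^ (q - 1))
  rw [add_div] at hsum
  rw [diazSaaIntegrand, diazSaaIntegrand, ← add_div]
  exact div_nonneg (by linarith) (by positivity)

/-- G-fractional Díaz–Saa inequality: for an N-function `G` satisfying (H4),
`0 < s < 1`, `Ω ⊂ ℝ^N` a bounded domain, `1 < q ≤ p⁻`, and `u, v ∈ W^{s,G}_0(Ω)` positive
a.e. in `Ω` with `u/v, v/u ∈ L^∞(Ω)`, both Díaz–Saa double integrals are well-defined
Lebesgue integrals and their sum is nonnegative. -/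
theorem G_fractional_diaz_saa
    {N : ℕ} (hN : 0 < N)
    (G g g' : ℝ → ℝ) (pm pp : ℝ) (hG : IsNFunction G)
    (hGg : ∀ t : ℝ, 0 < t → HasDerivAt G (g t) t)
    (hgg' : ∀ t : ℝ, 0 < t → HasDerivAt g (g' t) t)
    (hg'cont : ContinuousOn g' (Set.Ioi 0))
    (hpm : 1 < pm - 1) (hpmpp : pm ≤ pp)
    (hH4 : ∀ t : ℝ, 0 < t → pm - 1 ≤ t * g' t / g t ∧ t * g' t / g t ≤ pp - 1)
    (s : ℝ) (hs0 : 0 < s) (hs1 : s < 1)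
    (Ω : Set (Euc N)) (hΩopen : IsOpen Ω) (hΩbd : Bornology.IsBounded Ω)
    (hΩconn : IsConnected Ω)
    (q : ℝ) (hq1 : 1 < q) (hqpm : q ≤ pm)
    (u v : Euc N → ℝ)
    (hu : MemW0 G s Ω u) (hv : MemW0 G s Ω v)
    (hupos : ∀ᵐ x ∂(volume.restrict Ω), 0 < u x)
    (hvpos : ∀ᵐ x ∂(volume.restrict Ω), 0 < v x)
    (hratio : ∃ M : ℝ, ∀ᵐ x ∂(volume.restrict Ω), u x ≤ M * v x ∧ v x ≤ M * u x) :
    Integrable (diazSaaIntegrand g s q N u v) ∧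
    Integrable (diazSaaIntegrand g s q N v u) ∧
    0 ≤ (∫ p : Euc N × Euc N, diazSaaIntegrand g s q N u v p)
        + ∫ p : Euc N × Euc N, diazSaaIntegrand g s q N v u p := by
  have hpos : ∀ t : ℝ, 0 < t → 0 < g t := fun t ht => hG.deriv_pos hGg ht
  have hk0 : ∀ t : ℝ, 0 < t → 0 ≤ t * g' t / g t := fun t ht => by linarith [(hH4 t ht).1]
  have hgmono : MonotoneOn g (Ioi 0) := by
    simpa using monotoneOn_div_rpow hpos hgg' hk0
  have hqmono : MonotoneOn (fun t => g t / t ^ (q - 1)) (Ioi 0) :=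
    monotoneOn_div_rpow hpos hgg' fun t ht => by linarith [(hH4 t ht).1]
  have hgcont : ContinuousOn g (Ioi 0) := fun t ht =>
    (hgg' t ht).continuousAt.continuousWithinAt
  have hEu := hu.integrable_energy hG hGg hgg' hk0 fun t ht => (hH4 t ht).2
  have hEv := hv.integrable_energy hG hGg hgg' hk0 fun t ht => (hH4 t ht).2
  obtain ⟨M, hM⟩ := hratio
  have hcomp : ∀ᵐ x : Euc N, Comparable (max M 0) (u x) (v x) := by
    have hall := (hupos.and (hvpos.and hM))
    rw [ae_restrict_iff' hΩopen.measurableSet] at hall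
    filter_upwards [hall] with x hx
    by_cases hxΩ : x ∈ Ω
    · obtain ⟨h1, h2, h3, h4⟩ := hx hxΩ
      exact Or.inl ⟨h1, h2, h3.trans (by gcongr; exact le_max_left _ _),
        h4.trans (by gcongr; exact le_max_left _ _)⟩
    · exact Or.inr ⟨hu.2.2.2 x hxΩ, hv.2.2.2 x hxΩ⟩
  have hcomp2 : ∀ᵐ p : Euc N × Euc N,
      Comparable (max M 0) (u p.1) (v p.1) ∧ Comparable (max M 0) (u p.2) (v p.2) :=
    (Measure.quasiMeasurePreserving_fst.ae hcomp).and
      (Measure.quasiMeasurePreserving_snd.ae hcomp)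
  have hI1 : Integrable (diazSaaIntegrand g s q N u v) := by
    refine Integrable.mono' (((hEu.const_mul 2).add hEv).const_mul 
      (1 + q * max M 0 ^ (q - 1) + (q - 1) * max M 0 ^ q))
      (measurable_diazSaaIntegrand hgcont hu.1 hv.1).aestronglyMeasurable ?_
    filter_upwards [hcomp2] with p hp
    exact abs_diazSaaIntegrand_le hq1 (le_max_right M 0) hpos hgmono hp.1 hp.2
  have hI2 : Integrable (diazSaaIntegrand g s q N v u) := by
    refine Integrable.mono' (((hEv.const_mul 2).add hEu).const_mul 
      (1 + q * max M 0 ^ (q - 1) + (q - 1) * max M 0 ^ q))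
      (measurable_diazSaaIntegrand hgcont hv.1 hu.1).aestronglyMeasurable ?_
    filter_upwards [hcomp2] with p hp
    exact abs_diazSaaIntegrand_le hq1 (le_max_right M 0) hpos hgmono hp.1.symm hp.2.symm
  refine ⟨hI1, hI2, ?_⟩
  rw [← integral_add hI1 hI2]
  refine integral_nonneg_of_ae ?_
  filter_upwards [hcomp2] with p hp
  exact diazSaaIntegrand_add_nonneg hq1 hpos hqmono hp.1 hp.2
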